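/- Let ℏ, m, ω > 0 be real, s, f : ℝ → ℂ smooth, u = deriv s, define (a f)(x) = Real.sqrt (m*ω/(2*ℏ)) * x * f(x) + Real.sqrt (ℏ/(2*m*ω)) * deriv f x, (a† f)(x) = Real.sqrt (m*ω/(2*ℏ)) * x * f(x) - Real.sqrt (ℏ/(2*m*ω)) * deriv f x, and the multiplication operator (b f)(x) = Real.sqrt (ℏ/(2*m*ω)) * u x * f(x). Then for every x ∈ ℝ, (a† (b f))(x) - (b (a f))(x) = -(ℏ/(2*m*ω)) * (2 * u x * deriv f x + deriv u x * f x). -/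

import Mathlib

/-- The annihilation operator `(a f)(x) = √(mω/(2ℏ)) x f(x) + √(ℏ/(2mω)) f'(x)`. -/
noncomputable def annOp (ℏ m ω : ℝ) (f : ℝ → ℂ) : ℝ → ℂ := fun x =>
  (Real.sqrt (m * ω / (2 * ℏ)) : ℂ) * (x : ℂ) * f x
    + (Real.sqrt (ℏ / (2 * m * ω)) : ℂ) * deriv f x

/-- The creation operator `(a† f)(x) = √(mω/(2ℏ)) x f(x) - √(ℏ/(2mω)) f'(x)`. -/
noncomputable def creOp (ℏ m ω : ℝ) (f : ℝ → ℂ) : ℝ → ℂ := fun x =>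
  (Real.sqrt (m * ω / (2 * ℏ)) : ℂ) * (x : ℂ) * f x
    - (Real.sqrt (ℏ / (2 * m * ω)) : ℂ) * deriv f x

/-- The multiplication operator `(b f)(x) = √(ℏ/(2mω)) u(x) f(x)` with `u = deriv s`. -/
noncomputable def bOp (ℏ m ω : ℝ) (s : ℝ → ℂ) (f : ℝ → ℂ) : ℝ → ℂ := fun x =>
  (Real.sqrt (ℏ / (2 * m * ω)) : ℂ) * deriv s x * f x

/-- The mixed-term identity `N̂^{(mix)} = a†b - ba = -i ŵ^{(cl)}/ω`:
`(a†(b f))(x) - (b(a f))(x) = -(ℏ/(2mω)) (2 u(x) f'(x) + u_x(x) f(x))`, `u = deriv s`. -/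
theorem mixed_term_identity (ℏ m ω : ℝ) (hℏ : 0 < ℏ) (hm : 0 < m) (hω : 0 < ω)
    (s f : ℝ → ℂ) (hs : ContDiff ℝ (⊤ : ℕ∞) s) (hf : ContDiff ℝ (⊤ : ℕ∞) f) (u : ℝ → ℂ) (hu : u = deriv s)
    (x : ℝ) :
    creOp ℏ m ω (bOp ℏ m ω s f) x - bOp ℏ m ω s (annOp ℏ m ω f) x
      = -((ℏ / (2 * m * ω) : ℝ) : ℂ) * (2 * u x * deriv f x + deriv u x * f x) := by
  subst hu
  have hu : Differentiable ℝ (deriv s) :=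
    ((contDiff_infty_iff_deriv.1 hs).2).differentiable (by simp)
  have hf' : Differentiable ℝ f := hf.differentiable (by simp)
  have hb : deriv (bOp ℏ m ω s f) x = (Real.sqrt (ℏ / (2 * m * ω)) : ℂ) * deriv (deriv s) x * f x
      + (Real.sqrt (ℏ / (2 * m * ω)) : ℂ) * deriv s x * deriv f x :=
    (((hu x).hasDerivAt.const_mul _).mul (hf' x).hasDerivAt).deriv
  have hsq : ((ℏ / (2 * m * ω) : ℝ) : ℂ)
      = (Real.sqrt (ℏ / (2 * m * ω)) : ℂ) * (Real.sqrt (ℏ / (2 * m * ω)) : ℂ) := by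
    rw [← Complex.ofReal_mul, Real.mul_self_sqrt (by positivity)]
  rw [hsq, creOp, hb]
  simp only [bOp, annOp]
  ring
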